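/- Let F be the free group on x_0, x_1, x_2 and set x_3 := (x_0 x_1 x_2)^{−1}, and for i = 0, 1, 2, 3 let R_i be the normal closure of x_i in F. Then the element α̃_2 := [[x_0, x_2], [x_0 x_1, x_2]] belongs to R_0 ∩ R_1 ∩ R_2 ∩ R_3. -/

import Mathlib

open scoped commutatorElement

/-- The elements `x_0, x_1, x_2, x_3 = (x_0 x_1 x_2)⁻¹` of the free group on three
generators. -/
def xG (i : Fin 4) : FreeGroup (Fin 3) :=
  if h : (i : ℕ) < 3 then FreeGroup.of ⟨i, h⟩
  else (FreeGroup.of 0 * FreeGroup.of 1 * FreeGroup.of 2)⁻¹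

/-- `R_i`, the normal closure of `x_i` in `F`. -/
def RG (i : Fin 4) : Subgroup (FreeGroup (Fin 3)) :=
  Subgroup.normalClosure {xG i}

instance RG_normal_inst (i : Fin 4) : (RG i).Normal := Subgroup.normalClosure_normal

theorem xG_three : xG 3 = (xG 0 * xG 1 * xG 2)⁻¹ := rfl

theorem serre_mk_one (i : Fin 4) : (QuotientGroup.mk' (RG i)) (xG i) = 1 :=
  (QuotientGroup.eq_one_iff _).2 (Subgroup.subset_normalClosure rfl)

/-- Modulo `R_3`, the product `x_0 x_1` is the inverse of `x_2`. -/
theorem serre_mk_three : (QuotientGroup.mk' (RG 3)) (xG 0) * (QuotientGroup.mk' (RG 3)) (xG 1)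
    = ((QuotientGroup.mk' (RG 3)) (xG 2))⁻¹ := by
  have h := serre_mk_one 3
  rw [xG_three, map_inv, inv_eq_one, map_mul, map_mul] at h
  exact eq_inv_of_mul_eq_one_left h

/-- The four cases in an arbitrary group, with Mathlib's convention. -/
theorem serre_cases {G : Type*} [Group G] (a b c : G)
    (h : a = 1 ∨ b = 1 ∨ c = 1 ∨ a * b = c⁻¹) : ⁅⁅a, c⁆, ⁅a * b, c⁆⁆ = 1 := by
  rcases h with h | h | h | h
  · simp [h]
  · simp [h]
  · simp [h]
  · rw [h]
    simp [commutatorElement_def]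

/-- The four cases, with the convention `[a, b] = a⁻¹ b⁻¹ a b`, that is `⁅a⁻¹, b⁻¹⁆`
in Mathlib's convention. -/
theorem serre_cases_paper {G : Type*} [Group G] (a b c : G)
    (h : a = 1 ∨ b = 1 ∨ c = 1 ∨ a * b = c⁻¹) :
    ⁅⁅a⁻¹, c⁻¹⁆⁻¹, ⁅(a * b)⁻¹, c⁻¹⁆⁻¹⁆ = 1 := by
  rcases h with h | h | h | h
  · simp [h]
  · rw [h, mul_one, commutatorElement_self]
  · simp [h]
  · have h1 : ⁅c, c⁻¹⁆ = 1 := by simp [commutatorElement_def]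
    rw [h, inv_inv, h1, inv_one, commutatorElement_one_right]

theorem serre_mk_cases (i : Fin 4) :
    (QuotientGroup.mk' (RG i)) (xG 0) = 1 ∨ (QuotientGroup.mk' (RG i)) (xG 1) = 1 ∨
    (QuotientGroup.mk' (RG i)) (xG 2) = 1 ∨
    (QuotientGroup.mk' (RG i)) (xG 0) * (QuotientGroup.mk' (RG i)) (xG 1)
      = ((QuotientGroup.mk' (RG i)) (xG 2))⁻¹ := by
  fin_cases i
  · exact Or.inl (serre_mk_one 0)
  · exact Or.inr (Or.inl (serre_mk_one 1))
  · exact Or.inr (Or.inr (Or.inl (serre_mk_one 2)))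
  · exact Or.inr (Or.inr (Or.inr serre_mk_three))

/-- The membership for the element formed with the convention `[a, b] = a⁻¹ b⁻¹ a b`. -/
theorem serre_lift_mem_intersection_paper (i : Fin 4) :
    ⁅⁅(xG 0)⁻¹, (xG 2)⁻¹⁆⁻¹, ⁅(xG 0 * xG 1)⁻¹, (xG 2)⁻¹⁆⁻¹⁆ ∈ RG i := by
  rw [← QuotientGroup.ker_mk' (RG i), MonoidHom.mem_ker]
  simp only [map_commutatorElement, map_inv, map_mul]
  exact serre_cases_paper _ _ _ (serre_mk_cases i)

/-- The element `α̃_2 = [[x_0, x_2], [x_0 x_1, x_2]]` belongs to `R_0 ∩ R_1 ∩ R_2 ∩ R_3`. -/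
theorem serre_lift_mem_intersection :
    ∀ i : Fin 4, ⁅⁅xG 0, xG 2⁆, ⁅xG 0 * xG 1, xG 2⁆⁆ ∈ RG i := by
  intro i
  rw [← QuotientGroup.ker_mk' (RG i), MonoidHom.mem_ker]
  simp only [map_commutatorElement, map_mul]
  exact serre_cases _ _ _ (serre_mk_cases i)
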